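/- Let F = (V+r, E) be a flame and v ∈ V arbitrary. If a new edge e = (u,w) with u ∉ M^F_v and w ∈ M^F_v is added to E (that is, e enters M^F_v), then the resulting digraph F' = F + e is again a flame; moreover λ_{F'}(r,w) = λ_F(r,w) + 1. -/

import Mathlib

/- Common setup: a rooted digraph `D = (V+r, E)` is modelled as a finite
vertex type `α` (whose elements are `V ∪ {r}`), a finite edge type `E`
(allowing parallel edges, i.e. a multigraph) and maps `tail head : E → α`.
Subgraphs / edge subsets are sets `F : Set E`; the whole digraph `D`
corresponds to the edge set `Set.univ`.  "`v ∈ V`" is rendered as `v ≠ r`,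
and a vertex subset `X ⊆ V` as `X : Set α` with `r ∉ X`. -/

/-- In-degree of the vertex `v` in the digraph with edge set `F`. -/
noncomputable def inDeg {α E : Type*} (head : E → α) (F : Set E) (v : α) : ℕ :=
  {e ∈ F | head e = v}.ncard

/-- `ϱ_F(X)`: the number of edges of `F` entering the vertex set `X`
(tail outside `X`, head in `X`). -/
noncomputable def rho {α E : Type*} (tail head : E → α) (F : Set E) (X : Set α) : ℕ :=
  {e ∈ F | tail e ∉ X ∧ head e ∈ X}.ncard

/-- `p` is a directed path from `r` to `v` using edges of `F`:
a nonempty list of consecutive edges, starting at `r`, ending at `v`, and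
visiting pairwise distinct vertices. -/
def IsRVPath {α E : Type*} (tail head : E → α) (F : Set E) (r v : α) (p : List E) : Prop :=
  (∀ e ∈ p, e ∈ F) ∧
  List.Chain' (fun e f => head e = tail f) p ∧
  (p.map tail).Nodup ∧ (∀ e ∈ p, tail e ≠ v) ∧
  (∃ e, p.head? = some e ∧ tail e = r) ∧
  (∃ e, p.getLast? = some e ∧ head e = v)

/-- There exist `n` pairwise edge-disjoint directed paths from `r` to `v`
in the edge set `F`. -/
def HasEDPaths {α E : Type*} (tail head : E → α) (F : Set E) (r v : α) (n : ℕ) : Prop :=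
  ∃ P : Fin n → List E, (∀ i, IsRVPath tail head F r v (P i)) ∧
    ∀ i j, i ≠ j → ∀ e, e ∈ P i → e ∉ P j

/-- `λ_F(r,v)`: the local edge-connectivity from `r` to `v`, i.e. the maximum
number of pairwise edge-disjoint directed paths from `r` to `v` in `F`. -/
noncomputable def lam {α E : Type*} (tail head : E → α) (F : Set E) (r v : α) : ℕ :=
  sSup {n | HasEDPaths tail head F r v n}

/-- `X` is a `v`-tight vertex set in the digraph with edge set `F` and root `r`:
`X ⊆ V` (i.e. `r ∉ X`), `v ∈ X` and `ϱ_F(X) = λ_F(r,v)`. -/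
def Tight {α E : Type*} (tail head : E → α) (F : Set E) (r v : α) (X : Set α) : Prop :=
  v ∈ X ∧ r ∉ X ∧ rho tail head F X = lam tail head F r v

/-- The digraph with edge set `F` is a flame with root `r`:
`λ_F(r,v) = ϱ_F(v)` for every `v ∈ V`. -/
def IsFlame {α E : Type*} (tail head : E → α) (F : Set E) (r : α) : Prop :=
  ∀ v, v ≠ r → lam tail head F r v = inDeg head F v

/-- `F` is a maximal flame within the ambient edge set `A`:
`λ_A(r,v) = λ_F(r,v) = ϱ_F(v)` for every `v ∈ V`. -/
def IsMaxFlameIn {α E : Type*} (tail head : E → α) (A : Set E) (r : α) (F : Set E) : Prop :=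
  F ⊆ A ∧ ∀ v, v ≠ r →
    lam tail head A r v = lam tail head F r v ∧
    lam tail head F r v = inDeg head F v

/-- A closed directed walk in `F` with pairwise distinct edges.  (If every
vertex is entered by at most one edge of `F`, the existence of such a walk is
equivalent to the existence of an undirected cycle in `F`.) -/
def IsDicycle {α E : Type*} (tail head : E → α) (F : Set E) (p : List E) : Prop :=
  p.Nodup ∧ (∀ e ∈ p, e ∈ F) ∧
  List.Chain' (fun e f => head e = tail f) p ∧
  (∃ e f, p.head? = some e ∧ p.getLast? = some f ∧ head f = tail e)

/-- `B` is a branching: every vertex is entered by at most one edge of `B` and,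
disregarding edge directions, `B` contains no cycle (under the in-degree
condition this is equivalent to containing no directed cycle). -/
def IsBranching {α E : Type*} (tail head : E → α) (B : Set E) : Prop :=
  (∀ v, inDeg head B v ≤ 1) ∧ ∀ p : List E, ¬ IsDicycle tail head B p

/-- The head-set of an edge set `B`: the vertices entered by an edge of `B`. -/
def headSet {α E : Type*} (head : E → α) (B : Set E) : Set α := {v | ∃ e ∈ B, head e = v}

/-- Independence in the gammoid `G_D(v)` (with `D` the whole digraph, edge set
`Set.univ`): `X ⊆ in_D(v)` is independent if there are `|X|` pairwise
edge-disjoint directed paths from `r` to `v` in `D` whose set of last edges is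
exactly `X`. -/
def GammoidIndep {α E : Type*} (tail head : E → α) (r v : α) (X : Set E) : Prop :=
  ∃ P : Fin X.ncard → List E,
    (∀ i, IsRVPath tail head Set.univ r v (P i)) ∧
    (∀ i j, i ≠ j → ∀ e, e ∈ P i → e ∉ P j) ∧
    (∀ e, e ∈ X ↔ ∃ i, (P i).getLast? = some e)

/-- `IsWalk tail head F a b p`: the edge list `p` is a directed walk from `a` to `b` in `F`. -/
inductive IsWalk {α E : Type*} (tail head : E → α) (F : Set E) : α → α → List E → Prop
  | nil (a : α) : IsWalk tail head F a a []
  | cons {b : α} {p : List E} (e : E) (he : e ∈ F) (h : IsWalk tail head F (head e) b p) :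
      IsWalk tail head F (tail e) b (e :: p)

section Walks

variable {α E : Type*} {tail head : E → α} {F : Set E}

theorem IsWalk.mem {a b : α} {p : List E} (h : IsWalk tail head F a b p) :
    ∀ e ∈ p, e ∈ F := by
  induction h with
  | nil => simp
  | cons e he _ ih => simpa using ⟨he, ih⟩

theorem IsWalk.exists_entering {a b : α} {p : List E} (h : IsWalk tail head F a b p)
    {X : Set α} (ha : a ∉ X) (hb : b ∈ X) : ∃ e ∈ p, e ∈ F ∧ tail e ∉ X ∧ head e ∈ X := by
  induction h with
  | nil => exact absurd hb ha
  | cons e he _ ih =>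
    by_cases hX : head e ∈ X
    · exact ⟨e, by simp, he, ha, hX⟩
    · obtain ⟨f, hf, hf'⟩ := ih hX hb
      exact ⟨f, by simp [hf], hf'⟩

theorem IsWalk.exists_suffix {a b t : α} {p : List E} (h : IsWalk tail head F a b p)
    (ht : t ∈ p.map tail) : ∃ s, s <:+ p ∧ IsWalk tail head F t b s := by
  induction h with
  | nil => simp at ht
  | @cons b p e he h ih =>
    by_cases hte : t = tail e
    · subst hte
      exact ⟨e :: p, List.suffix_rfl, .cons e he h⟩
    · have ht' : t ∈ p.map tail := by simpa [hte] using ht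
      obtain ⟨s, hs, hw⟩ := ih ht'
      exact ⟨s, hs.trans (List.suffix_cons e p), hw⟩

/-- Every walk contains a walk with the same ends visiting pairwise distinct vertices. -/
theorem IsWalk.exists_nodup {a b : α} {p : List E} (h : IsWalk tail head F a b p) :
    ∃ q, IsWalk tail head F a b q ∧ (∀ e ∈ q, e ∈ p) ∧ (q.map tail).Nodup ∧
      ∀ e ∈ q, tail e ≠ b := by
  induction h with
  | nil a => exact ⟨[], .nil a, by simp⟩
  | @cons b p e he _ ih =>
    obtain ⟨q, hq, hsub, hnd, hb⟩ := ih
    by_cases hmem : tail e ∈ q.map tail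
    · obtain ⟨s, hs, hw⟩ := hq.exists_suffix hmem
      exact ⟨s, hw, fun f hf => List.mem_cons_of_mem _ (hsub f (hs.subset hf)),
        hnd.sublist (hs.sublist.map tail), fun f hf => hb f (hs.subset hf)⟩
    · by_cases heb : tail e = b
      · exact ⟨[], heb ▸ .nil _, by simp⟩
      · refine ⟨e :: q, .cons e he hq, ?_, ?_, ?_⟩
        · intro f hf
          rcases List.mem_cons.1 hf with rfl | hf
          · simp
          · exact List.mem_cons_of_mem _ (hsub f hf)
        · rw [List.map_cons, List.nodup_cons]
          exact ⟨hmem, hnd⟩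
        · intro f hf
          rcases List.mem_cons.1 hf with rfl | hf
          · exact heb
          · exact hb f hf

theorem IsWalk.isChain {a b : α} {p : List E} (h : IsWalk tail head F a b p) :
    List.IsChain (fun e f => head e = tail f) p ∧ ∀ e, p.head? = some e → tail e = a := by
  induction h with
  | nil => simp
  | cons e he _ ih =>
    refine ⟨List.isChain_cons.2 ⟨fun f hf => (ih.2 f hf).symm, ih.1⟩, ?_⟩
    rintro f hf
    obtain rfl : e = f := by simpa using hf
    rfl

theorem IsWalk.head_getLast {a b : α} {p : List E} (h : IsWalk tail head F a b p) :
    ∀ e, p.getLast? = some e → head e = b := by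
  induction h with
  | nil => simp
  | @cons b p e he h ih =>
    intro f hf
    rcases p with _ | ⟨g, p⟩
    · obtain rfl : e = f := by simpa using hf
      generalize head e = a at h
      cases h
      rfl
    · exact ih f (by simpa [List.getLast?_cons_cons] using hf)

theorem IsWalk.isRVPath {a b : α} {p : List E} (h : IsWalk tail head F a b p) (hab : a ≠ b)
    (hnd : (p.map tail).Nodup) (hb : ∀ e ∈ p, tail e ≠ b) :
    IsRVPath tail head F a b p := by
  have hp : p ≠ [] := by
    rintro rfl
    cases h
    exact hab rfl
  exact ⟨h.mem, h.isChain.1, hnd, hb,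
    ⟨p.head hp, List.head?_eq_some_head hp, h.isChain.2 _ (List.head?_eq_some_head hp)⟩,
    ⟨p.getLast hp, List.getLast?_eq_some_getLast hp,
      h.head_getLast _ (List.getLast?_eq_some_getLast hp)⟩⟩

theorem isWalk_of_isChain {b : α} (p : List E) (hF : ∀ e ∈ p, e ∈ F)
    (hc : List.IsChain (fun e f => head e = tail f) p)
    (hl : ∃ e, p.getLast? = some e ∧ head e = b) {a : α}
    (ha : ∃ e, p.head? = some e ∧ tail e = a) : IsWalk tail head F a b p := by
  induction p generalizing a with
  | nil => simp at ha
  | cons e p ih =>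
    obtain ⟨e', he', rfl⟩ := ha
    obtain rfl : e = e' := by simpa using he'
    refine .cons e (hF e (by simp)) ?_
    rcases p with _ | ⟨g, p⟩
    · obtain ⟨f, hf, rfl⟩ := hl
      obtain rfl : e = f := by simpa using hf
      exact .nil _
    · have hc' := List.isChain_cons.1 hc
      exact ih (fun f hf => hF f (List.mem_cons_of_mem _ hf)) hc'.2
        (by simpa [List.getLast?_cons_cons] using hl) ⟨g, rfl, (hc'.1 g (by simp)).symm⟩

theorem IsRVPath.isWalk {r v : α} {p : List E} (h : IsRVPath tail head F r v p) :
    IsWalk tail head F r v p :=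
  isWalk_of_isChain p h.1 h.2.1 h.2.2.2.2.2 h.2.2.2.2.1

theorem IsWalk.mono {G : Set E} (hFG : F ⊆ G) {a b : α} {p : List E}
    (h : IsWalk tail head F a b p) : IsWalk tail head G a b p := by
  induction h with
  | nil a => exact .nil a
  | cons e he _ ih => exact .cons e (hFG he) ih

/-- If the edge `g`, whose tail is the head of `f`, is redirected to start at the tail of `f`,
then replacing `g` by `f, g` turns walks back into walks of the original digraph. -/
theorem IsWalk.of_update_tail [DecidableEq E] {f g : E} (hf : f ∈ F) (hfg : tail g = head f)
    {a b : α} {p : List E}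
    (h : IsWalk (Function.update tail g (tail f)) head (F \ {f}) a b p) :
    ∃ q, IsWalk tail head F a b q ∧ ∀ e ∈ q, e ∈ p ∨ (e = f ∧ g ∈ p) := by
  induction h with
  | nil a => exact ⟨[], .nil a, by simp⟩
  | @cons b p e he _ ih =>
    obtain ⟨q, hq, hsub⟩ := ih
    by_cases heg : e = g
    · subst heg
      refine ⟨f :: e :: q, ?_, ?_⟩
      · rw [Function.update_self]
        refine .cons f hf ?_
        rw [← hfg]
        exact .cons e he.1 hq
      · intro d hd
        simp only [List.mem_cons] at hd ⊢
        have := hsub d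
        tauto
    · refine ⟨e :: q, ?_, ?_⟩
      · rw [Function.update_of_ne heg]
        exact .cons e he.1 hq
      · intro d hd
        simp only [List.mem_cons] at hd ⊢
        have := hsub d
        tauto

end Walks

section Cuts

variable {α E : Type*} [Finite E] {tail head : E → α} {F : Set E}

theorem rho_inter_add_rho_union_le (X Y : Set α) :
    rho tail head F (X ∩ Y) + rho tail head F (X ∪ Y) ≤
      rho tail head F X + rho tail head F Y := by
  unfold rho
  rw [← Set.ncard_union_add_ncard_inter, ← Set.ncard_union_add_ncard_inter
    {e ∈ F | tail e ∉ X ∧ head e ∈ X}]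
  refine add_le_add (Set.ncard_le_ncard ?_ (Set.toFinite _))
    (Set.ncard_le_ncard ?_ (Set.toFinite _))
  all_goals
    intro e he
    simp only [Set.mem_union, Set.mem_inter_iff, Set.mem_ofPred_eq] at he ⊢
    tauto

theorem rho_mono {G : Set E} (hFG : F ⊆ G) (X : Set α) :
    rho tail head F X ≤ rho tail head G X :=
  Set.ncard_le_ncard (fun _ he => ⟨hFG he.1, he.2⟩) (Set.toFinite _)

theorem rho_le_rho_diff_singleton_add_one (f : E) (X : Set α) :
    rho tail head F X ≤ rho tail head (F \ {f}) X + 1 := by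
  have h : {e ∈ F | tail e ∉ X ∧ head e ∈ X} ⊆
      insert f {e ∈ F \ {f} | tail e ∉ X ∧ head e ∈ X} := by
    intro e he
    by_cases hef : e = f
    · exact Or.inl hef
    · exact Or.inr ⟨⟨he.1, hef⟩, he.2⟩
  exact (Set.ncard_le_ncard h (Set.toFinite _)).trans (Set.ncard_insert_le _ _)

theorem rho_le_rho_diff_singleton {f : E} {X : Set α} (hf : head f ∉ X) :
    rho tail head F X ≤ rho tail head (F \ {f}) X := by
  refine Set.ncard_le_ncard (fun e he => ⟨⟨he.1, ?_⟩, he.2⟩) (Set.toFinite _)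
  rintro rfl
  exact hf he.2.2

theorem rho_insert {e : E} {X : Set α} (he : e ∉ F) (ht : tail e ∉ X) (hh : head e ∈ X) :
    rho tail head (insert e F) X = rho tail head F X + 1 := by
  unfold rho
  rw [← Set.ncard_insert_of_notMem (a := e) (fun h => he h.1) (Set.toFinite _)]
  congr 1
  ext d
  simp only [Set.mem_insert_iff, Set.mem_ofPred_eq]
  constructor
  · tauto
  · rintro (rfl | h)
    · exact ⟨Or.inl rfl, ht, hh⟩
    · exact ⟨Or.inr h.1, h.2⟩

theorem rho_le_rho_update_tail [DecidableEq E] (g : E) {r : α} {X : Set α} (hr : r ∉ X) :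
    rho tail head F X ≤ rho (Function.update tail g r) head F X := by
  refine Set.ncard_le_ncard (fun e he => ⟨he.1, ?_, he.2.2⟩) (Set.toFinite _)
  by_cases heg : e = g
  · rwa [heg, Function.update_self]
  · rw [Function.update_of_ne heg]
    exact he.2.1

theorem rho_add_one_le_rho_update_tail [DecidableEq E] {g : E} {r : α} {X : Set α}
    (hr : r ∉ X) (hg : g ∈ F) (ht : tail g ∈ X) (hh : head g ∈ X) :
    rho tail head F X + 1 ≤ rho (Function.update tail g r) head F X := by
  unfold rho
  rw [← Set.ncard_insert_of_notMem (a := g) (fun h => h.2.1 ht) (Set.toFinite _)]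
  refine Set.ncard_le_ncard ?_ (Set.toFinite _)
  rintro e (rfl | he)
  · exact ⟨hg, by rwa [Function.update_self], hh⟩
  · have heg : e ≠ g := fun h => he.2.1 (h ▸ ht)
    exact ⟨he.1, by rw [Function.update_of_ne heg]; exact he.2.1, he.2.2⟩

end Cuts

/-- Menger's theorem for edge-disjoint walks. The proof splits off pairs of consecutive edges
starting at `r`. -/
theorem exists_disjoint_walks {α E : Type*} [Finite α] [Finite E] (head : E → α) {r w : α}
    (hw : w ≠ r) (tail : E → α) (F : Set E) (k : ℕ)
    (hcut : ∀ X : Set α, w ∈ X → r ∉ X → k ≤ rho tail head F X) :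
    ∃ P : Fin k → List E, (∀ i, IsWalk tail head F r w (P i)) ∧
      ∀ i j, i ≠ j → ∀ e, e ∈ P i → e ∉ P j := by
  classical
  induction hn : F.ncard generalizing tail F k with
  | zero =>
    have hk := hcut {w} rfl (by simpa using hw.symm)
    have hF : F = ∅ := by simpa [Set.toFinite F] using hn
    obtain rfl : k = 0 := by simpa [rho, hF] using hk
    exact ⟨fun i => i.elim0, fun i => i.elim0, fun i => i.elim0⟩
  | succ n ih =>
    rcases k with _ | k
    · exact ⟨fun i => i.elim0, fun i => i.elim0, fun i => i.elim0⟩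
    obtain ⟨f, hf, hft, hfh⟩ : ∃ f ∈ F, tail f = r ∧ head f ≠ r := by
      have h := hcut {r}ᶜ (by simpa using hw) (by simp)
      obtain ⟨f, hf⟩ := (Set.ncard_pos (Set.toFinite _)).1 (Nat.lt_of_lt_of_le k.succ_pos h)
      exact ⟨f, hf.1, by simpa using hf.2.1, hf.2.2⟩
    have hcard : (F \ {f}).ncard = n := by
      rw [Set.ncard_sdiff_singleton_of_mem hf, hn, Nat.add_sub_cancel]
    by_cases hfw : head f = w
    · obtain ⟨P, hP, hdisj⟩ := ih tail (F \ {f}) k (fun X hX hr =>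
        Nat.le_of_add_le_add_right
          ((hcut X hX hr).trans (rho_le_rho_diff_singleton_add_one f X))) hcard
      have hfP : ∀ i, f ∉ P i := fun i h => ((hP i).mem f h).2 rfl
      refine ⟨Fin.cons [f] P, ?_, ?_⟩
      · refine Fin.cases ?_ (fun i => ?_)
        · have h : IsWalk tail head F (tail f) w [f] := .cons f hf (hfw ▸ .nil _)
          simpa [hft] using h
        · simpa using (hP i).mono Set.sdiff_subset
      · refine Fin.cases (Fin.cases (by simp) ?_) (fun i => Fin.cases ?_ ?_)
        · intro j _ e he
          obtain rfl : e = f := by simpa using he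
          simpa using hfP j
        · intro _ e he he'
          obtain rfl : e = f := by simpa using he'
          exact hfP i (by simpa using he)
        · intro j hij e he
          simpa using hdisj i j (by simpa using hij) e (by simpa using he)
    by_cases htight : ∃ T : Set α,
        w ∈ T ∧ r ∉ T ∧ head f ∈ T ∧ rho tail head F T = k + 1
    · obtain ⟨T, hT⟩ := (Set.toFinite {T : Set α |
        w ∈ T ∧ r ∉ T ∧ head f ∈ T ∧ rho tail head F T = k + 1}).exists_minimal htight
      obtain ⟨⟨hwT, hrT, hfT, hTk⟩, hmin⟩ := hT
      obtain ⟨g, hg, hgt, hgh⟩ : ∃ g ∈ F, tail g = head f ∧ head g ∈ T := by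
        by_contra! hno
        have h := hcut (T \ {head f}) ⟨hwT, fun h => hfw h.symm⟩ (fun h => hrT h.1)
        rw [← hTk] at h
        refine absurd h (not_le_of_gt (Set.ncard_lt_ncard ?_ (Set.toFinite _)))
        refine (Set.ssubset_iff_of_subset ?_).2
          ⟨f, ⟨hf, by rwa [hft], hfT⟩, fun h => h.2.2.2 rfl⟩
        intro e he
        refine ⟨he.1, fun heT => he.2.1 ⟨heT, fun h => ?_⟩, he.2.2.1⟩
        exact hno e he.1 h he.2.2.1
      have hgf : g ≠ f := fun h => hfh (by rw [← hgt, h, hft])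
      obtain ⟨P, hP, hdisj⟩ := ih (Function.update tail g (tail f)) (F \ {f}) (k + 1) (by
        rw [hft]
        intro X hX hr
        have hup := rho_le_rho_update_tail (tail := tail) (head := head) (F := F \ {f}) g hr
        have hdel := rho_le_rho_diff_singleton_add_one (tail := tail) (head := head) (F := F) f X
        have hXk := hcut X hX hr
        by_cases hfX : head f ∈ X
        · by_cases hXt : rho tail head F X = k + 1
          · have hsub := rho_inter_add_rho_union_le (tail := tail) (head := head) (F := F) T X
            have hi := hcut (T ∩ X) ⟨hwT, hX⟩ (fun h => hr h.2)
            have hu := hcut (T ∪ X) (Or.inr hX) (fun h => h.elim hrT hr)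
            have hTX : T ⊆ T ∩ X := hmin (y := T ∩ X)
              ⟨⟨hwT, hX⟩, fun h => hr h.2, ⟨hfT, hfX⟩, by omega⟩ Set.inter_subset_left
            have hup' := rho_add_one_le_rho_update_tail (tail := tail) (head := head)
              (F := F \ {f}) (g := g) hr ⟨hg, hgf⟩ (hgt ▸ hfX) (hTX hgh).2
            omega
          · omega
        · exact hXk.trans ((rho_le_rho_diff_singleton hfX).trans hup)) hcard
      choose Q hQ hQsub using fun i => (hP i).of_update_tail hf hgt
      refine ⟨Q, hQ, fun i j hij e hi hj => ?_⟩
      have hfP : ∀ i, f ∉ P i := fun i h => ((hP i).mem f h).2 rfl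
      rcases hQsub i e hi with hi | ⟨rfl, hi⟩ <;> rcases hQsub j e hj with hj | ⟨h, hj⟩
      · exact hdisj i j hij e hi hj
      · exact hfP i (h ▸ hi)
      · exact hfP j hj
      · exact hdisj i j hij g hi hj
    · obtain ⟨P, hP, hdisj⟩ := ih tail (F \ {f}) (k + 1) (fun X hX hr => by
        have hXk := hcut X hX hr
        by_cases hfX : head f ∈ X
        · have hne : rho tail head F X ≠ k + 1 := fun h => htight ⟨X, hX, hr, hfX, h⟩
          have hdel := rho_le_rho_diff_singleton_add_one (tail := tail) (head := head)
            (F := F) f X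
          omega
        · exact hXk.trans (rho_le_rho_diff_singleton hfX)) hcard
      exact ⟨P, fun i => (hP i).mono Set.sdiff_subset, hdisj⟩

section Connectivity

variable {α E : Type*} [Finite E] {tail head : E → α} {F : Set E} {r v : α}

theorem HasEDPaths.le_rho {n : ℕ} (h : HasEDPaths tail head F r v n) {X : Set α}
    (hv : v ∈ X) (hr : r ∉ X) : n ≤ rho tail head F X := by
  obtain ⟨P, hP, hdisj⟩ := h
  choose g hg hgX using fun i => (hP i).isWalk.exists_entering hr hv
  have hinj : Function.Injective g := fun i j hij => by
    by_contra hne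
    exact hdisj i j hne (g i) (hg i) (hij ▸ hg j)
  calc n = (Set.range g).ncard := by
        rw [← Set.image_univ, Set.ncard_image_of_injective _ hinj]; simp
    _ ≤ _ := Set.ncard_le_ncard (Set.range_subset_iff.2 hgX) (Set.toFinite _)

theorem lam_le_rho {X : Set α} (hv : v ∈ X) (hr : r ∉ X) :
    lam tail head F r v ≤ rho tail head F X :=
  csSup_le ⟨0, fun i => i.elim0, fun i => i.elim0, fun i => i.elim0⟩
    fun _ hn => HasEDPaths.le_rho hn hv hr

theorem lam_le_inDeg (hv : v ≠ r) : lam tail head F r v ≤ inDeg head F v :=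
  (lam_le_rho (X := {v}) rfl (fun h => hv h.symm)).trans
    (Set.ncard_le_ncard (fun _ he => ⟨he.1, he.2.2⟩) (Set.toFinite _))

/-- Menger's theorem: a lower bound on all cuts is a lower bound on the edge-connectivity. -/
theorem le_lam_of_forall_le_rho [Finite α] (hv : v ≠ r) {k : ℕ}
    (hcut : ∀ X : Set α, v ∈ X → r ∉ X → k ≤ rho tail head F X) :
    k ≤ lam tail head F r v := by
  obtain ⟨P, hP, hdisj⟩ := exists_disjoint_walks head hv tail F k hcut
  choose Q hQ hsub hnd hb using fun i => (hP i).exists_nodup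
  refine le_csSup ⟨rho tail head F {v}, fun n hn =>
    HasEDPaths.le_rho hn rfl (fun h => hv h.symm)⟩
    ⟨Q, fun i => (hQ i).isRVPath hv.symm (hnd i) (hb i), fun i j hij e hi hj => ?_⟩
  exact hdisj i j hij e (hsub i e hi) (hsub j e hj)

theorem inDeg_insert_head {e : E} (he : e ∉ F) :
    inDeg head (insert e F) (head e) = inDeg head F (head e) + 1 := by
  unfold inDeg
  rw [← Set.ncard_insert_of_notMem (a := e) (fun h => he h.1) (Set.toFinite _)]
  congr 1
  ext d
  simp only [Set.mem_insert_iff, Set.mem_ofPred_eq]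
  constructor
  · tauto
  · rintro (rfl | h)
    · exact ⟨Or.inl rfl, rfl⟩
    · exact ⟨Or.inr h.1, h.2⟩

end Connectivity

theorem inDeg_insert_of_ne {α E : Type*} {head : E → α} {F : Set E} {v : α} {e : E}
    (h : head e ≠ v) :
    inDeg head (insert e F) v = inDeg head F v := by
  unfold inDeg
  congr 1
  ext d
  simp only [Set.mem_insert_iff, Set.mem_ofPred_eq]
  constructor
  · rintro ⟨rfl | hd, hd'⟩
    · exact absurd hd' h
    · exact ⟨hd, hd'⟩
  · exact fun hd => ⟨Or.inr hd.1, hd.2⟩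

/-- if `F` is a flame, `v ∈ V`, and a new edge `e = (u,w)` with
`u ∉ M^F_v` and `w ∈ M^F_v` is added (where `M^F_v` is the largest `v`-tight
set of `F`), then `F + e` is again a flame, and `λ_{F+e}(r,w) = λ_F(r,w) + 1`. -/
theorem flame_insert_edge_entering_largest_tight
    {α E : Type*} [Fintype α] [Fintype E]
    (tail head : E → α) (r v : α) (hv : v ≠ r)
    (F : Set E) (hflame : IsFlame tail head F r)
    (M : Set α)
    (hM : Tight tail head F r v M ∧ ∀ X : Set α, Tight tail head F r v X → X ⊆ M)
    (e : E) (he : e ∉ F) (hu : tail e ∉ M) (hw : head e ∈ M) :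
    IsFlame tail head (insert e F) r ∧
    lam tail head (insert e F) r (head e) = lam tail head F r (head e) + 1 := by
  obtain ⟨⟨hvM, hrM, hMk⟩, hmax⟩ := hM
  have hwr : head e ≠ r := fun h => hrM (h ▸ hw)
  have hle : lam tail head F r (head e) + 1 ≤ lam tail head (insert e F) r (head e) := by
    refine le_lam_of_forall_le_rho hwr fun X hX hr => ?_
    have hXlam : lam tail head F r (head e) ≤ rho tail head F X := lam_le_rho hX hr
    have hXmono := rho_mono (tail := tail) (head := head) (Set.subset_insert e F) X
    by_cases ht : tail e ∈ X
    · by_contra! hlt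
      have hsub := rho_inter_add_rho_union_le (tail := tail) (head := head) (F := F) X M
      have hi : lam tail head F r (head e) ≤ rho tail head F (X ∩ M) :=
        lam_le_rho ⟨hX, hw⟩ (fun h => hr h.1)
      have hru : r ∉ X ∪ M := fun h => h.elim hr hrM
      have hun : lam tail head F r v ≤ rho tail head F (X ∪ M) := lam_le_rho (Or.inr hvM) hru
      exact hu (hmax (X ∪ M) ⟨Or.inr hvM, hru, by omega⟩ (Or.inl ht))
    · rw [rho_insert he ht hX]
      omega
  have hup := lam_le_inDeg (tail := tail) (head := head) (F := insert e F) hwr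
  rw [inDeg_insert_head he, ← hflame _ hwr] at hup
  refine ⟨fun x hx => ?_, hup.antisymm hle⟩
  by_cases hxe : head e = x
  · subst hxe
    rw [inDeg_insert_head he, ← hflame _ hx]
    exact hup.antisymm hle
  · refine (lam_le_inDeg hx).antisymm ?_
    rw [inDeg_insert_of_ne hxe, ← hflame x hx]
    exact le_lam_of_forall_le_rho hx fun X hX hr =>
      (lam_le_rho hX hr).trans (rho_mono (Set.subset_insert e F) X)
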